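/- arXiv:2207.07401 — 2 statements merged into one kernel-verified Lean document; each statement's English description precedes it below -/
import Mathlib

section
/- Let λ be a regular uncountable cardinal. For every coloring c : [λ]² → 2, either there is a stationary set T ⊆ λ such that c is constantly 0 on [T]², or there is a set B ⊆ λ of order type ω+1 such that c is constantly 1 on [B]². In particular, λ → (λ, ω+1)² holds for every regular uncountable λ. -/
open Cardinal Set

noncomputable section

/-- `F` is a (proper) filter on the cardinal `κ`; subsets of `κ` are coded as
sets of ordinals below `κ.ord`. -/
def IsFilterOn (κ : Cardinal.{0}) (F : Set (Set Ordinal.{0})) : Prop :=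
  (∀ A ∈ F, A ⊆ Set.Iio κ.ord) ∧
  Set.Iio κ.ord ∈ F ∧
  (∅ : Set Ordinal) ∉ F ∧
  (∀ A ∈ F, ∀ B : Set Ordinal, B ⊆ Set.Iio κ.ord → A ⊆ B → B ∈ F) ∧
  (∀ A ∈ F, ∀ B ∈ F, A ∩ B ∈ F)

/-- `F` is `κ`-complete: closed under intersections of fewer than `κ` of its members. -/
def IsKappaComplete (κ : Cardinal.{0}) (F : Set (Set Ordinal.{0})) : Prop :=
  ∀ S : Set (Set Ordinal.{0}), S ⊆ F → S.Nonempty →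
    Cardinal.mk ↥S < Cardinal.lift.{1, 0} κ → ⋂₀ S ∈ F

/-- `F` contains every co-bounded subset of `κ`. -/
def ContainsCobounded (κ : Cardinal.{0}) (F : Set (Set Ordinal.{0})) : Prop :=
  ∀ γ < κ.ord, {x : Ordinal | γ ≤ x ∧ x < κ.ord} ∈ F

/-- `F` is an ultrafilter on `κ`. -/
def IsUltraOn (κ : Cardinal.{0}) (F : Set (Set Ordinal.{0})) : Prop :=
  IsFilterOn κ F ∧
  ∀ A : Set Ordinal, A ⊆ Set.Iio κ.ord → (A ∈ F ∨ Set.Iio κ.ord \ A ∈ F)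

/-- `x ⊆* A` modulo sets of size `< κ`. -/
def AlmostSub (κ : Cardinal.{0}) (x A : Set Ordinal.{0}) : Prop :=
  Cardinal.mk ↥(x \ A) < Cardinal.lift.{1, 0} κ

/-- Galvin's property `Gal(F, μ, ν)`: every `ν`-indexed family of members of `F`
admits a subfamily of `μ` many indices whose intersection belongs to `F`. -/
def GalvinProp (F : Set (Set Ordinal.{0})) (μ ν : Cardinal.{0}) : Prop :=
  ∀ C : Ordinal → Set Ordinal, (∀ γ < ν.ord, C γ ∈ F) →
    ∃ I : Set Ordinal, I ⊆ Set.Iio ν.ord ∧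
      Cardinal.mk ↥I = Cardinal.lift.{1, 0} μ ∧ (⋂ γ ∈ I, C γ) ∈ F

/-- `B` is a set of ordinals of order type `ω + 1`. -/
def OtpOmegaSucc (B : Set Ordinal.{0}) : Prop :=
  ∃ (g : ℕ → Ordinal.{0}) (t : Ordinal.{0}), StrictMono g ∧ (∀ n, g n < t) ∧
    B = Set.range g ∪ {t}

/-- `c` is constantly `i` on the pairs from `H`. -/
def Mono (c : Ordinal.{0} → Ordinal.{0} → Fin 2) (H : Set Ordinal.{0}) (i : Fin 2) : Prop :=
  ∀ α ∈ H, ∀ β ∈ H, α < β → c α β = i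

/-- The partition relation `λ → (λ, ω + 1)²`. -/
def PartitionOmegaSuccRel (lam : Cardinal.{0}) : Prop :=
  ∀ c : Ordinal.{0} → Ordinal.{0} → Fin 2,
    (∃ H : Set Ordinal.{0}, H ⊆ Set.Iio lam.ord ∧
      Cardinal.mk ↥H = Cardinal.lift.{1, 0} lam ∧ Mono c H 0) ∨
    (∃ B : Set Ordinal.{0}, B ⊆ Set.Iio lam.ord ∧ OtpOmegaSucc B ∧ Mono c B 1)

/-- `C` is a club (closed unbounded set) in `o`. -/
def IsClubIn (C : Set Ordinal.{0}) (o : Ordinal.{0}) : Prop :=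
  C ⊆ Set.Iio o ∧ (∀ γ < o, ∃ x ∈ C, γ ≤ x) ∧
  (∀ S : Set Ordinal.{0}, S ⊆ C → S.Nonempty → sSup S < o → sSup S ∈ C)

/-- `T` is stationary in `o`. -/
def IsStationaryIn (T : Set Ordinal.{0}) (o : Ordinal.{0}) : Prop :=
  T ⊆ Set.Iio o ∧ ∀ C : Set Ordinal.{0}, IsClubIn C o → (T ∩ C).Nonempty

theorem sSup_lt_ord_of_mk_lt {κ : Cardinal.{0}} (hreg : κ.IsRegular) {S : Set Ordinal.{0}}
    (hS : #S < Cardinal.lift.{1, 0} κ) (hlt : ∀ x ∈ S, x < κ.ord) : sSup S < κ.ord := by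
  refine Ordinal.sSup_lt_of_lt_cof ?_ hlt
  rwa [← Ordinal.lift_cof, hreg.cof_ord]

theorem mk_finset_Iio_lt {κ : Cardinal.{0}} (hunc : ℵ₀ < κ) {γ : Ordinal.{0}} (hγ : γ < κ.ord) :
    #(Finset (Set.Iio γ)) < Cardinal.lift.{1, 0} κ := by
  have hlt : #(Set.Iio γ) < Cardinal.lift.{1, 0} κ := by
    rw [Cardinal.mk_Iio_ordinal, Cardinal.lift_lt]
    exact Cardinal.lt_ord.1 hγ
  rcases finite_or_infinite (Set.Iio γ) with _ | _
  · exact (Cardinal.lt_aleph0_of_finite _).trans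
      (by rwa [← Cardinal.lift_aleph0.{1, 0}, Cardinal.lift_lt])
  · rwa [Cardinal.mk_finset_of_infinite]

/-- The diagonal intersection of a family of clubs indexed by finite sets of ordinals. -/
theorem IsClubIn.diagonal_finset {κ : Cardinal.{0}} (hreg : κ.IsRegular) (hunc : ℵ₀ < κ)
    {C : Finset Ordinal.{0} → Set Ordinal.{0}} (hC : ∀ x, IsClubIn (C x) κ.ord) :
    IsClubIn {α | α < κ.ord ∧ ∀ x : Finset Ordinal.{0}, (∀ y ∈ x, y < α) → α ∈ C x} κ.ord := by
  have hlim : Order.IsSuccLimit κ.ord := Cardinal.isSuccLimit_ord hreg.aleph0_le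
  refine ⟨fun α hα => hα.1, ?_, ?_⟩
  · have hnext : ∀ γ : Ordinal.{0}, ∃ δ, γ < κ.ord → δ < κ.ord ∧ γ < δ ∧
        ∀ x : Finset Ordinal.{0}, (∀ y ∈ x, y < γ) → ∃ z ∈ C x, γ ≤ z ∧ z < δ := by
      intro γ
      by_cases hγ : γ < κ.ord
      swap
      · exact ⟨0, fun h => absurd h hγ⟩
      choose N hN hγN using fun x => (hC x).2.1 γ hγ
      let f : Finset (Set.Iio γ) → Ordinal.{0} := fun x => N (x.map (Function.Embedding.subtype _))
      have hf : ∀ z ∈ Set.range f, z < κ.ord := by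
        rintro _ ⟨x, rfl⟩
        exact (hC _).1 (hN _)
      have hsup : sSup (Set.range f) < κ.ord := sSup_lt_ord_of_mk_lt hreg
        (Cardinal.mk_range_le.trans_lt (mk_finset_Iio_lt hunc hγ)) hf
      refine ⟨Order.succ (max γ (sSup (Set.range f))), fun _ =>
        ⟨hlim.succ_lt (max_lt hγ hsup), Order.lt_succ_of_le (le_max_left _ _), ?_⟩⟩
      intro x hx
      refine ⟨N x, hN x, hγN x, Order.lt_succ_of_le (le_max_of_le_right ?_)⟩
      refine le_csSup ⟨κ.ord, fun z hz => (hf z hz).le⟩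
        ⟨x.subtype (· ∈ Set.Iio γ), congrArg N ?_⟩
      exact Finset.subtype_map_of_mem hx
    choose D hD using hnext
    intro γ hγ
    let g : ℕ → Ordinal.{0} := fun n => D^[n] γ
    have hgs : ∀ n, g (n + 1) = D (g n) := fun n => Function.iterate_succ_apply' D n γ
    have hg : ∀ n, g n < κ.ord := by
      intro n
      induction n with
      | zero => exact hγ
      | succ n ih => rw [hgs]; exact (hD _ ih).1
    have hmono : StrictMono g := strictMono_nat_of_lt_succ fun n => by
      rw [hgs]; exact (hD _ (hg n)).2.1
    have hbdd : BddAbove (Set.range g) := ⟨κ.ord, by rintro _ ⟨n, rfl⟩; exact (hg n).le⟩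
    have hsup : sSup (Set.range g) < κ.ord := by
      refine sSup_lt_ord_of_mk_lt hreg ?_ (by rintro _ ⟨n, rfl⟩; exact hg n)
      refine (Cardinal.mk_le_aleph0_iff.2 (Set.countable_range g).to_subtype).trans_lt ?_
      rwa [← Cardinal.lift_aleph0.{1, 0}, Cardinal.lift_lt]
    refine ⟨sSup (Set.range g), ⟨hsup, fun x hx => ?_⟩, le_csSup hbdd ⟨0, rfl⟩⟩
    obtain ⟨m, hm⟩ : ∃ m, ∀ y ∈ x, y < g m := by
      choose! n hn using fun y (hy : y ∈ x) =>
        (exists_lt_of_lt_csSup (Set.range_nonempty g) (hx y hy) : ∃ b ∈ Set.range g, y < b)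
      choose! k hk using fun y (hy : y ∈ x) => (hn y hy).1
      refine ⟨x.sup k, fun y hy => ?_⟩
      refine (hn y hy).2.trans_le ?_
      rw [← hk y hy]
      exact hmono.monotone (Finset.le_sup hy)
    have hz : ∀ i, ∃ z ∈ C x, g (m + i) ≤ z ∧ z < g (m + i + 1) := fun i => by
      rw [hgs]
      exact (hD _ (hg _)).2.2 x fun y hy =>
        (hm y hy).trans_le (hmono.monotone (Nat.le_add_right m i))
    choose z hzC hgz hzg using hz
    have heq : sSup (Set.range z) = sSup (Set.range g) := by
      apply le_antisymm
      · refine csSup_le (Set.range_nonempty z) ?_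
        rintro _ ⟨i, rfl⟩
        exact (hzg i).le.trans (le_csSup hbdd ⟨_, rfl⟩)
      · refine csSup_le (Set.range_nonempty g) ?_
        rintro _ ⟨i, rfl⟩
        refine (hmono.monotone (Nat.le_add_left i m)).trans ((hgz i).trans ?_)
        exact le_csSup ⟨κ.ord, by rintro _ ⟨j, rfl⟩; exact ((hC x).1 (hzC j)).le⟩ ⟨i, rfl⟩
    rw [← heq]
    exact (hC x).2.2 _ (by rintro _ ⟨i, rfl⟩; exact hzC i) (Set.range_nonempty z) (heq ▸ hsup)
  · intro S hS hne hlt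
    have hbdd : BddAbove S := ⟨κ.ord, fun s hs => (hS hs).1.le⟩
    refine ⟨hlt, fun x hx => ?_⟩
    obtain ⟨s, hs, hxs⟩ : ∃ s ∈ S, ∀ y ∈ x, y < s := by
      rcases x.eq_empty_or_nonempty with rfl | hxne
      · exact hne.imp fun s hs => ⟨hs, by simp⟩
      · obtain ⟨s, hs, hlt⟩ := exists_lt_of_lt_csSup hne (hx _ (x.max'_mem hxne))
        exact ⟨s, hs, fun y hy => (x.le_max' y hy).trans_lt hlt⟩
    have heq : sSup (S ∩ Set.Ici s) = sSup S := by
      refine le_antisymm (csSup_le_csSup hbdd ⟨s, hs, Set.self_mem_Ici⟩ Set.inter_subset_left) ?_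
      refine csSup_le hne fun t ht => ?_
      have hbdd' : BddAbove (S ∩ Set.Ici s) := hbdd.mono Set.inter_subset_left
      rcases le_total s t with hst | hts
      · exact le_csSup hbdd' ⟨ht, hst⟩
      · exact hts.trans (le_csSup hbdd' ⟨hs, Set.self_mem_Ici⟩)
    rw [← heq]
    exact (hC x).2.2 _ (fun t ht => (hS ht.1).2 x fun y hy => (hxs y hy).trans_le ht.2)
      ⟨s, hs, Set.self_mem_Ici⟩ (heq ▸ hlt)

/-- Pressing down for finite-set-valued functions: some fiber is stationary. -/
theorem exists_isStationaryIn_fiber {κ : Cardinal.{0}} (hreg : κ.IsRegular) (hunc : ℵ₀ < κ)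
    {f : Ordinal.{0} → Finset Ordinal.{0}} (hf : ∀ α < κ.ord, ∀ y ∈ f α, y < α) :
    ∃ x, IsStationaryIn {α | α < κ.ord ∧ f α = x} κ.ord := by
  by_contra! h
  have h' : ∀ x, ∃ C, IsClubIn C κ.ord ∧ ¬ ({α | α < κ.ord ∧ f α = x} ∩ C).Nonempty := by
    intro x
    by_contra! hx
    exact h x ⟨fun α hα => hα.1, hx⟩
  choose C hC hdisj using h'
  obtain ⟨α, ⟨hα, hmem⟩, -⟩ := (IsClubIn.diagonal_finset hreg hunc hC).2.1 0 hreg.ord_pos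
  exact hdisj (f α) ⟨α, ⟨hα, rfl⟩, hmem _ (hf α hα)⟩

theorem IsStationaryIn.mk_eq {κ : Cardinal.{0}} (hreg : κ.IsRegular) {T : Set Ordinal.{0}}
    (hT : IsStationaryIn T κ.ord) : #T = Cardinal.lift.{1, 0} κ := by
  apply le_antisymm
  · simpa using Cardinal.mk_le_mk_of_subset hT.1
  by_contra! hlt
  have hsup := sSup_lt_ord_of_mk_lt hreg hlt fun x hx => hT.1 hx
  have hsucc := (Cardinal.isSuccLimit_ord hreg.aleph0_le).succ_lt hsup
  have hclub : IsClubIn (Set.Ico (Order.succ (sSup T)) κ.ord) κ.ord := by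
    refine ⟨fun α hα => hα.2, fun γ hγ => ⟨max γ (Order.succ (sSup T)),
      ⟨le_max_right _ _, max_lt hγ hsucc⟩, le_max_left _ _⟩, ?_⟩
    rintro S hS ⟨s, hs⟩ hlt
    exact ⟨(hS hs).1.trans (le_csSup ⟨κ.ord, fun x hx => (hS hx).2.le⟩ hs), hlt⟩
  obtain ⟨α, hαT, hα, -⟩ := hT.2 _ hclub
  exact (Order.succ_le_iff.1 hα).not_ge (le_csSup ⟨κ.ord, fun x hx => (hT.1 hx).le⟩ hαT)

theorem exists_otpOmegaSucc_mono {c : Ordinal.{0} → Ordinal.{0} → Fin 2} {α : Ordinal.{0}}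
    (h : ∀ x : Finset Ordinal.{0}, (∀ y ∈ x, y < α) → Mono c (insert α (x : Set Ordinal)) 1 →
      ∃ β < α, (∀ y ∈ x, y < β) ∧ Mono c (insert α (insert β (x : Set Ordinal))) 1) :
    ∃ B ⊆ Set.Iic α, OtpOmegaSucc B ∧ Mono c B 1 := by
  let P := {x : Finset Ordinal.{0} // (∀ y ∈ x, y < α) ∧ Mono c (insert α (x : Set Ordinal)) 1}
  have hstep : ∀ p : P, ∃ β, ∃ q : P, (∀ y ∈ p.1, y < β) ∧ q.1 = insert β p.1 := by
    rintro ⟨x, hx, hmono⟩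
    obtain ⟨β, hβ, hxβ, hm⟩ := h x hx hmono
    refine ⟨β, ⟨insert β x, ?_, by simpa using hm⟩, hxβ, rfl⟩
    simpa using ⟨hβ, hx⟩
  choose b q hb hq using hstep
  have hempty : Mono c (insert α ((∅ : Finset Ordinal) : Set Ordinal)) 1 := by
    simp [Mono]
  let s : ℕ → P := fun n => q^[n] ⟨∅, by simp, hempty⟩
  have hs : ∀ n, (s (n + 1)).1 = insert (b (s n)) (s n).1 := fun n => by
    rw [← hq]; exact congrArg _ (Function.iterate_succ_apply' q n _)
  have hmem : ∀ i j, i < j → b (s i) ∈ (s j).1 := by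
    intro i j hij
    induction j, hij using Nat.le_induction with
    | base => rw [hs]; exact Finset.mem_insert_self _ _
    | succ j _ ih => rw [hs]; exact Finset.mem_insert_of_mem ih
  have hlt : ∀ n, b (s n) < α := fun n => (s (n + 1)).2.1 _ (hmem n _ n.lt_succ_self)
  refine ⟨Set.range (fun n => b (s n)) ∪ {α}, ?_, ⟨fun n => b (s n), α, ?_, hlt, rfl⟩, ?_⟩
  · rintro _ (⟨n, rfl⟩ | rfl)
    · exact (hlt n).le
    · exact Set.self_mem_Iic
  · exact strictMono_nat_of_lt_succ fun n => hb _ _ (hmem n _ n.lt_succ_self)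
  · have hin : ∀ β ∈ Set.range (fun n => b (s n)) ∪ {α}, ∃ n, ∀ m, n ≤ m →
        β ∈ insert α ((s m).1 : Set Ordinal) := by
      rintro _ (⟨n, rfl⟩ | rfl)
      · exact ⟨n + 1, fun m hm => Or.inr (hmem n m hm)⟩
      · exact ⟨0, fun m _ => Or.inl rfl⟩
    intro β hβ γ hγ hβγ
    obtain ⟨m, hm⟩ := hin β hβ
    obtain ⟨n, hn⟩ := hin γ hγ
    exact (s (max m n)).2.2 β (hm _ (le_max_left _ _)) γ (hn _ (le_max_right _ _)) hβγ

theorem exists_stationary_mono_or_otpOmegaSucc_mono {κ : Cardinal.{0}} (hreg : κ.IsRegular)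
    (hunc : ℵ₀ < κ) (c : Ordinal.{0} → Ordinal.{0} → Fin 2) :
    (∃ T : Set Ordinal.{0}, IsStationaryIn T κ.ord ∧ Mono c T 0) ∨
      ∃ B : Set Ordinal.{0}, B ⊆ Set.Iio κ.ord ∧ OtpOmegaSucc B ∧ Mono c B 1 := by
  refine or_iff_not_imp_right.2 fun hB => ?_
  have hmax : ∀ α : Ordinal.{0}, ∃ x : Finset Ordinal.{0}, α < κ.ord → (∀ y ∈ x, y < α) ∧
      Mono c (insert α (x : Set Ordinal)) 1 ∧ ∀ β < α, (∀ y ∈ x, y < β) →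
        ¬ Mono c (insert α (insert β (x : Set Ordinal))) 1 := by
    intro α
    by_contra! h
    obtain ⟨B, hBα, hotp, hmono⟩ := exists_otpOmegaSucc_mono fun x => (h x).2
    exact hB ⟨B, fun β hβ => (hBα hβ).trans_lt (h ∅).1, hotp, hmono⟩
  choose f hf using hmax
  obtain ⟨x, hx⟩ := exists_isStationaryIn_fiber hreg hunc fun α hα => (hf α hα).1
  refine ⟨_, hx, ?_⟩
  rintro α ⟨hα, rfl⟩ β ⟨hβ, hfβ⟩ hαβ
  by_contra hne
  have hc : c α β = 1 := by omega
  obtain ⟨hxα, hmα, -⟩ := hf α hα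
  obtain ⟨hxβ, hmβ, hnot⟩ := hf β hβ
  rw [hfβ] at hxβ hmβ hnot
  refine hnot α hαβ hxα ?_
  have hbelow : ∀ y ∈ insert α (f α : Set Ordinal), y < β := by
    rintro y (rfl | hy)
    exacts [hαβ, hxβ y hy]
  rintro y (rfl | hy) z (rfl | hz) hyz
  · exact absurd hyz (lt_irrefl _)
  · exact absurd hyz (hbelow z hz).not_gt
  · rcases hy with rfl | hy
    · exact hc
    · exact hmβ y (Or.inr hy) z (Or.inl rfl) hyz
  · exact hmα y hy z hz hyz

/-- for regular uncountable `λ`, every `2`-coloring of pairs from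
`λ` admits either a stationary `0`-monochromatic set or a `1`-monochromatic set
of order type `ω + 1`; in particular `λ → (λ, ω+1)²`. -/
theorem stationary_or_omegaSucc (lam : Cardinal.{0}) (hreg : lam.IsRegular)
    (hunc : ℵ₀ < lam) :
    (∀ c : Ordinal.{0} → Ordinal.{0} → Fin 2,
      (∃ T : Set Ordinal.{0}, IsStationaryIn T lam.ord ∧ Mono c T 0) ∨
      (∃ B : Set Ordinal.{0}, B ⊆ Set.Iio lam.ord ∧ OtpOmegaSucc B ∧ Mono c B 1)) ∧
    PartitionOmegaSuccRel lam := by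
  have h := exists_stationary_mono_or_otpOmegaSucc_mono hreg hunc
  exact ⟨h, fun c => (h c).imp_left fun ⟨T, hT, hmono⟩ => ⟨T, hT.1, hT.mk_eq hreg, hmono⟩⟩
end
end

section
/- Suppose 𝒰 is a normal κ-complete ultrafilter over a measurable cardinal κ, λ is a singular cardinal with cf(λ) = κ > ℵ₀, and Gal(𝒰, μ, μ) holds for cofinally many regular cardinals μ < λ (i.e. for every ordinal below λ there is a regular cardinal μ above it and below λ, with μ > κ, such that every family of μ many members of 𝒰 admits a subfamily of μ many indices whose intersection belongs to 𝒰). Then λ → (λ, ω+1)². -/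
open Cardinal Set

noncomputable section

/-- `F` is normal: closed under diagonal intersections of `κ`-sequences of members. -/
def IsNormalOn (κ : Cardinal.{0}) (F : Set (Set Ordinal.{0})) : Prop :=
  ∀ A : Ordinal → Set Ordinal.{0}, (∀ α < κ.ord, A α ∈ F) →
    {β : Ordinal | β < κ.ord ∧ ∀ α < β, β ∈ A α} ∈ F

/-- The dual ideal of `F` contains every subset of `κ` of size `< κ`. -/
def SmallSetsInDual (κ : Cardinal.{0}) (F : Set (Set Ordinal.{0})) : Prop :=
  ∀ S : Set Ordinal.{0}, S ⊆ Set.Iio κ.ord →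
    Cardinal.mk ↥S < Cardinal.lift.{1, 0} κ → Set.Iio κ.ord \ S ∈ F


/-- The points above `α` joined to `α` in colour `1`. -/
def oneAbove (c : Ordinal.{0} → Ordinal.{0} → Fin 2) (α : Ordinal.{0}) : Set Ordinal.{0} :=
  {β | α < β ∧ c α β = 1}

theorem otpOmegaSucc_and_mono_of_seq {c : Ordinal.{0} → Ordinal.{0} → Fin 2}
    {g : ℕ → Ordinal.{0}} {t : Ordinal.{0}} (hg : ∀ m n, m < n → g n ∈ oneAbove c (g m))
    (ht : ∀ n, t ∈ oneAbove c (g n)) :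
    OtpOmegaSucc (range g ∪ {t}) ∧ Mono c (range g ∪ {t}) 1 := by
  have hmono : StrictMono g := fun m n h => (hg m n h).1
  refine ⟨⟨g, t, hmono, fun n => (ht n).1, rfl⟩, ?_⟩
  rintro α (⟨m, rfl⟩ | rfl) β (⟨n, rfl⟩ | rfl) hlt
  · exact (hg m n (hmono.lt_iff_lt.1 hlt)).2
  · exact (ht m).2
  · exact absurd hlt (ht n).1.not_gt
  · exact absurd hlt (lt_irrefl _)

theorem exists_maximal_mono (c : Ordinal.{0} → Ordinal.{0} → Fin 2) (Y : Set Ordinal.{0}) :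
    ∃ Z ⊆ Y, Mono c Z 0 ∧
      ∀ t ∈ Y, (∀ a ∈ Z, a < t) → ∃ a ∈ Z, t ∈ oneAbove c a := by
  obtain ⟨Z, hZ⟩ := zorn_subset {Z | Z ⊆ Y ∧ Mono c Z 0} (by
    intro C hC hchain
    refine ⟨⋃₀ C, ⟨sUnion_subset fun s hs => (hC hs).1, ?_⟩, fun s hs => subset_sUnion_of_mem hs⟩
    rintro α ⟨s, hs, hα⟩ β ⟨s', hs', hβ⟩ hlt
    rcases hchain.total hs hs' with h | h
    · exact (hC hs').2 α (h hα) β hβ hlt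
    · exact (hC hs).2 α hα β (h hβ) hlt)
  refine ⟨Z, hZ.prop.1, hZ.prop.2, fun t ht hlt => ?_⟩
  by_contra! hno
  have hins : insert t Z ∈ {Z | Z ⊆ Y ∧ Mono c Z 0} := by
    refine ⟨insert_subset ht hZ.prop.1, ?_⟩
    rintro α (rfl | hα) β (rfl | hβ) hαβ
    · exact absurd hαβ (lt_irrefl _)
    · exact absurd hαβ (hlt β hβ).not_gt
    · have h1 : c α β ≠ 1 := fun h => hno α hα ⟨hαβ, h⟩
      omega
    · exact hZ.prop.2 α hα β hβ hαβ
  exact lt_irrefl t (hlt t (hZ.le_of_ge hins (subset_insert t Z) (mem_insert t Z)))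

/-- The partition relation `μ → (μ, ω + 1)²` for uncountable regular `μ`. -/
theorem exists_mono_or_omegaSucc_of_isRegular {μ : Cardinal.{0}} (hμ : μ.IsRegular)
    (hunc : ℵ₀ < μ) (c : Ordinal.{0} → Ordinal.{0} → Fin 2) {X : Set Ordinal.{0}}
    (hX : X ⊆ Iio μ.ord) (hcard : Cardinal.lift.{1, 0} μ ≤ #X) :
    (∃ H ⊆ X, Cardinal.lift.{1, 0} μ ≤ #H ∧ Mono c H 0) ∨
      ∃ B ⊆ X, OtpOmegaSucc B ∧ Mono c B 1 := by
  refine or_iff_not_imp_left.2 fun hno => ?_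
  push Not at hno
  have hreg : (Cardinal.lift.{1, 0} μ).IsRegular := hμ.lift
  choose Z hZY hZmono hZmax using exists_maximal_mono c
  let T : ℕ → Set (Set Ordinal.{0}) :=
    fun n => Nat.rec {X} (fun _ A => ⋃ Y ∈ A, (fun α => Y ∩ oneAbove c α) '' Z Y) n
  have hTsucc (n) : T (n + 1) = ⋃ Y ∈ T n, (fun α => Y ∩ oneAbove c α) '' Z Y := rfl
  have hTX (n) : ∀ Y ∈ T n, Y ⊆ X := by
    induction n with
    | zero => intro Y hY; exact (mem_singleton_iff.1 hY).subset
    | succ n ih =>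
      intro Y hY
      simp only [hTsucc, mem_iUnion, mem_image] at hY
      obtain ⟨Y', hY', α, -, rfl⟩ := hY
      exact inter_subset_left.trans (ih Y' hY')
  have hZsmall {Y} (hY : Y ⊆ X) : #(Z Y) < Cardinal.lift.{1, 0} μ := by
    by_contra! h
    exact hno (Z Y) ((hZY Y).trans hY) h (hZmono Y)
  have hTsmall (n) : #↥(T n) < Cardinal.lift.{1, 0} μ := by
    induction n with
    | zero =>
      change #({X} : Set (Set Ordinal)) < _
      rw [Cardinal.mk_singleton]
      exact Cardinal.one_lt_aleph0.trans_le hreg.aleph0_le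
    | succ n ih =>
      rw [hTsucc]
      exact (card_biUnion_lt_iff_forall_of_isRegular hreg ih).2 fun Y hY =>
        mk_image_le.trans_lt (hZsmall (hTX n Y hY))
  have hW : #(⋃ n, ⋃ Y ∈ T n, Z Y : Set Ordinal.{0}) < Cardinal.lift.{1, 0} μ := by
    rw [← ULift.down_surjective.{_, 1}.iUnion_comp fun n => ⋃ Y ∈ T n, Z Y]
    refine (card_iUnion_lt_iff_forall_of_isRegular hreg ?_).2 fun n => ?_
    · simpa using hunc
    · exact (card_biUnion_lt_iff_forall_of_isRegular hreg (hTsmall n.down)).2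
        fun Y hY => hZsmall (hTX _ Y hY)
  have hV : #(⋃ α ∈ (⋃ n, ⋃ Y ∈ T n, Z Y : Set Ordinal.{0}), Iio (α + 1) : Set Ordinal.{0})
      < Cardinal.lift.{1, 0} μ := by
    refine (card_biUnion_lt_iff_forall_of_isRegular hreg hW).2 fun α hα => ?_
    simp only [mem_iUnion] at hα
    obtain ⟨n, Y, hY, hα⟩ := hα
    rw [Cardinal.mk_Iio_ordinal, Cardinal.lift_lt, ← Cardinal.lt_ord]
    exact (isSuccLimit_ord hμ.aleph0_le).add_one_lt (hX (hTX n Y hY (hZY Y hα)))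
  obtain ⟨t, htX, ht⟩ : ∃ t ∈ X, ∀ n, ∀ Y ∈ T n, ∀ α ∈ Z Y, α < t := by
    by_contra! h
    refine (hcard.trans (mk_le_mk_of_subset fun t ht => ?_)).not_gt hV
    obtain ⟨n, Y, hY, α, hα, hle⟩ := h t ht
    exact mem_biUnion (mem_iUnion.2 ⟨n, mem_biUnion hY hα⟩) (Order.lt_add_one_iff.2 hle)
  let State := {Y : Set Ordinal.{0} // (∃ n, Y ∈ T n) ∧ t ∈ Y}
  have hstep (Y : State) : ∃ p : State × Ordinal.{0}, p.2 ∈ Y.1 ∧ t ∈ oneAbove c p.2 ∧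
      p.1.1 = Y.1 ∩ oneAbove c p.2 := by
    obtain ⟨Y, ⟨n, hY⟩, htY⟩ := Y
    obtain ⟨α, hα, hαt⟩ := hZmax Y t htY (ht n Y hY)
    refine ⟨⟨⟨Y ∩ oneAbove c α, ⟨n + 1, ?_⟩, htY, hαt⟩, α⟩, hZY Y hα, hαt, rfl⟩
    rw [hTsucc]
    exact mem_biUnion hY ⟨α, hα, rfl⟩
  choose next hnext_mem hnext_t hnext using hstep
  let s : ℕ → State := fun n => (fun Y => (next Y).1)^[n] ⟨X, ⟨0, rfl⟩, htX⟩
  let g : ℕ → Ordinal.{0} := fun n => (next (s n)).2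
  have hs (n) : (s (n + 1)).1 = (s n).1 ∩ oneAbove c (g n) := by
    simp only [s, g, Function.iterate_succ_apply']
    exact hnext _
  have hanti : Antitone fun n => (s n).1 :=
    antitone_nat_of_succ_le fun n => (hs n).trans_subset inter_subset_left
  have hB := otpOmegaSucc_and_mono_of_seq (c := c) (g := g) (t := t)
    (fun m n hmn => ((hs m).subset (hanti (Nat.succ_le_of_lt hmn) (hnext_mem (s n)))).2)
    (fun n => hnext_t (s n))
  refine ⟨_, ?_, hB⟩
  rintro _ (⟨n, rfl⟩ | rfl)
  · obtain ⟨k, hk⟩ := (s n).2.1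
    exact hTX k _ hk (hnext_mem (s n))
  · exact htX

/-- A map from a large set into a small set is constant on a large set. -/
theorem exists_large_fiber {μ : Cardinal.{0}} (hμ : μ.IsRegular) {X : Set Ordinal.{0}}
    (hcard : Cardinal.lift.{1, 0} μ ≤ #X) (f : Ordinal.{0} → Ordinal.{0}) {θ : Ordinal.{0}}
    (hθ : θ.card < μ) (hf : ∀ β ∈ X, f β < θ) :
    ∃ ρ, Cardinal.lift.{1, 0} μ ≤ #{β ∈ X | f β = ρ} := by
  by_contra! h
  have hsmall : #(⋃ ρ ∈ Iio θ, {β ∈ X | f β = ρ}) < Cardinal.lift.{1, 0} μ :=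
    (card_biUnion_lt_iff_forall_of_isRegular hμ.lift
      (by rwa [Cardinal.mk_Iio_ordinal, Cardinal.lift_lt])).2 fun ρ _ => h ρ
  refine (hcard.trans (mk_le_mk_of_subset fun β hβ => ?_)).not_gt hsmall
  exact mem_biUnion (hf β hβ) ⟨hβ, rfl⟩

/-- If no `ω`-sequence below `δ` is end-extended to a colour-`1` set of type `ω + 1` by a point
of `X`, the finite subsets of `δ` can be ranked, for each point of `X`, so that the rank drops
along colour-`1` end-extensions. -/
theorem exists_rank {c : Ordinal.{0} → Ordinal.{0} → Fin 2} {δ : Ordinal.{0}} {ν : Cardinal.{0}}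
    (hν : ℵ₀ ≤ ν) (hδ : δ.card ≤ ν) {t : Ordinal.{0}} (ht : ∀ g : ℕ → Ordinal.{0},
      (∀ n, g n < δ) → (∀ m n, m < n → g n ∈ oneAbove c (g m)) →
      ¬ ∀ n, t ∈ oneAbove c (g n)) :
    ∃ R : Finset Ordinal.{0} → Ordinal.{0}, (∀ s, R s < (Order.succ ν).ord) ∧
      ∀ s : Finset Ordinal.{0}, ∀ α < δ, (∀ a ∈ s, α ∈ oneAbove c a) → t ∈ oneAbove c α →
        R (insert α s) < R s := by
  classical
  let r : Finset (Iio δ) → Finset (Iio δ) → Prop := fun s' s => ∃ α : Iio δ,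
    (∀ a ∈ s, α.1 ∈ oneAbove c a.1) ∧ t ∈ oneAbove c α.1 ∧ s' = insert α s
  have hwf : IsWellFounded _ r := ⟨by
    rw [wellFounded_iff_isEmpty_descending_chain]
    refine ⟨fun ⟨f, hf⟩ => ?_⟩
    choose g hg hgt hfg using hf
    have hmono : Monotone f := monotone_nat_of_le_succ fun n => by
      rw [hfg n]; exact Finset.subset_insert _ _
    refine ht (fun n => (g n).1) (fun n => (g n).2) (fun m n hmn => hg n (g m) ?_) hgt
    refine hmono (Nat.succ_le_of_lt hmn) ?_
    rw [Nat.succ_eq_add_one, hfg m]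
    exact Finset.mem_insert_self _ _⟩
  have hbound (s) : IsWellFounded.rank r s < Ordinal.lift.{1} (Order.succ ν).ord := by
    rw [Cardinal.lift_ord, Cardinal.lt_ord, Cardinal.lift_succ, Order.lt_succ_iff,
      ← Cardinal.lift_le.{2}, ← Cardinal.mk_Iio_ordinal]
    have h1 : Iio (IsWellFounded.rank r s) ⊆ range (IsWellFounded.rank r) :=
      fun o ho => IsWellFounded.mem_range_rank_of_le (le_of_lt ho)
    have h2 := (Cardinal.lift_le.{1}.2 (mk_le_mk_of_subset h1)).trans
      (mk_range_le_lift (f := IsWellFounded.rank r))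
    have h3 : #(Finset (Iio δ)) ≤ Cardinal.lift.{1} ν := by
      rcases finite_or_infinite (Iio δ) with hfin | hinf
      · exact (Cardinal.lt_aleph0_of_finite _).le.trans (by simpa using hν)
      · rw [Cardinal.mk_finset_of_infinite, Cardinal.mk_Iio_ordinal]
        exact Cardinal.lift_le.2 hδ
    rw [Cardinal.lift_id'.{1, 2}] at h2
    exact h2.trans (Cardinal.lift_le.2 h3)
  have hex (s) : ∃ o : Ordinal.{0}, Ordinal.lift.{1} o = IsWellFounded.rank r s :=
    Ordinal.mem_range_lift_of_le (hbound s).le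
  choose R hR using hex
  refine ⟨fun s => R (s.subtype (· ∈ Iio δ)), fun s => ?_, fun s α hα hs hαt => ?_⟩
  · rw [← Ordinal.lift_lt.{1}]
    change Ordinal.lift.{1} (R _) < _
    rw [hR]
    exact hbound _
  · rw [← Ordinal.lift_lt.{1}]
    change Ordinal.lift.{1} (R _) < Ordinal.lift.{1} (R _)
    rw [hR, hR]
    refine IsWellFounded.rank_lt_of_rel ⟨⟨α, hα⟩, fun a ha => ?_, hαt, ?_⟩
    · exact hs _ (Finset.mem_subtype.1 ha)
    · ext a
      simp [Subtype.ext_iff]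

/-- The filter on the ordinals generated by a filter on `κ`. -/
def IsFilterOn.toFilter {κ : Cardinal.{0}} {U : Set (Set Ordinal.{0})} (hU : IsFilterOn κ U) :
    Filter Ordinal.{0} where
  sets := {A | A ∩ Iio κ.ord ∈ U}
  univ_sets := by simpa using hU.2.1
  sets_of_superset {A B} hA hAB :=
    hU.2.2.2.1 _ hA _ inter_subset_right (inter_subset_inter_left _ hAB)
  inter_sets {A B} hA hB := by
    have h := hU.2.2.2.2 _ hA _ hB
    rwa [← inter_inter_distrib_right] at h

section ToFilter

variable {κ : Cardinal.{0}} {U : Set (Set Ordinal.{0})}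

theorem IsFilterOn.eventually_iff (hU : IsFilterOn κ U) {p : Ordinal.{0} → Prop} :
    (∀ᶠ i in hU.toFilter, p i) ↔ {i | p i} ∩ Iio κ.ord ∈ U :=
  Iff.rfl

theorem IsFilterOn.eventually_of_mem (hU : IsFilterOn κ U) {A : Set Ordinal.{0}} (hA : A ∈ U) :
    ∀ᶠ i in hU.toFilter, i ∈ A := by
  rw [hU.eventually_iff, ofPred_mem_eq, inter_eq_left.2 (hU.1 A hA)]
  exact hA

theorem IsFilterOn.eventually_lt (hU : IsFilterOn κ U) : ∀ᶠ i in hU.toFilter, i < κ.ord :=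
  hU.eventually_of_mem hU.2.1

theorem IsFilterOn.toFilter_neBot (hU : IsFilterOn κ U) : hU.toFilter.NeBot := by
  refine Filter.neBot_iff.2 fun h => ?_
  rw [← Filter.empty_mem_iff_bot] at h
  have h' : ∅ ∩ Iio κ.ord ∈ U := h
  rw [empty_inter] at h'
  exact hU.2.2.1 h'

theorem IsUltraOn.eventually_not (hU : IsUltraOn κ U) {p : Ordinal.{0} → Prop}
    (hp : ¬ ∀ᶠ i in hU.1.toFilter, p i) : ∀ᶠ i in hU.1.toFilter, ¬ p i := by
  rw [hU.1.eventually_iff] at hp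
  filter_upwards [hU.1.eventually_of_mem
    ((hU.2 _ inter_subset_right).resolve_left hp)] with i hi hpi
  exact hi.2 ⟨hpi, hi.1⟩

theorem IsFilterOn.eventually_gt (hU : IsFilterOn κ U) (hcb : ContainsCobounded κ U)
    (hκ : ℵ₀ ≤ κ) {i : Ordinal.{0}} (hi : i < κ.ord) : ∀ᶠ j in hU.toFilter, i < j := by
  filter_upwards [hU.eventually_of_mem (hcb _ ((isSuccLimit_ord hκ).add_one_lt hi))] with j hj
  exact Order.add_one_le_iff.1 hj.1

theorem IsFilterOn.eventually_forall_nat (hU : IsFilterOn κ U) (hcomp : IsKappaComplete κ U)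
    (hκ : ℵ₀ < κ) {p : ℕ → Ordinal.{0} → Prop} (hp : ∀ n, ∀ᶠ i in hU.toFilter, p n i) :
    ∀ᶠ i in hU.toFilter, ∀ n, p n i := by
  have h : ⋂₀ range (fun n => {i | p n i} ∩ Iio κ.ord) ∈ U := by
    refine hcomp _ (range_subset_iff.2 hp) (range_nonempty _) ?_
    exact (Cardinal.mk_le_aleph0_iff.2 (countable_range _).to_subtype).trans_lt (by simpa using hκ)
  filter_upwards [hU.eventually_of_mem h] with i hi n
  exact (hi _ (mem_range_self n)).1

theorem IsFilterOn.eventually_diag (hU : IsFilterOn κ U) (hnorm : IsNormalOn κ U)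
    {p : Ordinal.{0} → Ordinal.{0} → Prop}
    (hp : ∀ a < κ.ord, ∀ᶠ i in hU.toFilter, p a i) : ∀ᶠ i in hU.toFilter, ∀ a < i, p a i := by
  filter_upwards [hU.eventually_of_mem (hnorm (fun a => {i | p a i} ∩ Iio κ.ord) hp)]
    with i hi a ha
  exact (hi.2 a ha).1

theorem GalvinProp.exists_large {μ : Cardinal.{0}} (hgal : GalvinProp U μ μ)
    (hU : IsFilterOn κ U) {Y : Set Ordinal.{0}} (hY : Cardinal.lift.{1, 0} μ ≤ #Y)
    {p : Ordinal.{0} → Ordinal.{0} → Prop} (hp : ∀ α ∈ Y, ∀ᶠ i in hU.toFilter, p α i) :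
    ∃ Y' ⊆ Y, Cardinal.lift.{1, 0} μ ≤ #Y' ∧ ∀ᶠ i in hU.toFilter, ∀ α ∈ Y', p α i := by
  classical
  have hle : #(Iio μ.ord) ≤ #Y := by rwa [Cardinal.mk_Iio_ordinal, Cardinal.card_ord]
  obtain ⟨e⟩ := hle
  let f : Ordinal.{0} → Ordinal.{0} := fun γ => if h : γ < μ.ord then e ⟨γ, h⟩ else 0
  have hf {γ} (h : γ < μ.ord) : f γ = e ⟨γ, h⟩ := dif_pos h
  have hfY {γ} (h : γ < μ.ord) : f γ ∈ Y := by rw [hf h]; exact (e ⟨γ, h⟩).2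
  have hinj : InjOn f (Iio μ.ord) := by
    intro a ha b hb hab
    rw [hf ha, hf hb] at hab
    exact congrArg Subtype.val (e.injective (Subtype.ext hab))
  obtain ⟨I, hI, hIcard, hIU⟩ := hgal (fun γ => {i | p (f γ) i} ∩ Iio κ.ord)
    fun γ hγ => hp _ (hfY hγ)
  refine ⟨f '' I, ?_, ?_, ?_⟩
  · rintro _ ⟨γ, hγ, rfl⟩
    exact hfY (hI hγ)
  · rw [Cardinal.mk_image_eq_of_injOn _ _ (hinj.mono hI), hIcard]
  · filter_upwards [hU.eventually_of_mem hIU] with i hi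
    rintro _ ⟨γ, hγ, rfl⟩
    exact (mem_iInter₂.1 hi γ hγ).1

end ToFilter

/-- A sequence of regular cardinals `μ i`, for `i < κ`, each far above the bound `δ i` of the
preceding ones. -/
structure IsLadder (κ : Cardinal.{0}) (δ : Ordinal.{0} → Ordinal.{0})
    (μ : Ordinal.{0} → Cardinal.{0}) : Prop where
  isRegular {i} : i < κ.ord → (μ i).IsRegular
  aleph0_lt {i} : i < κ.ord → ℵ₀ < μ i
  exists_succ_lt {i} : i < κ.ord → ∃ ν, ℵ₀ ≤ ν ∧ (δ i).card ≤ ν ∧ Order.succ ν < μ i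
  le_of_lt {i j} : i < j → j < κ.ord → (μ i).ord ≤ δ j

theorem exists_isLadder {κ lam : Cardinal.{0}} (hcof : lam.ord.cof = κ)
    {P : Cardinal.{0} → Prop} (hκ : ℵ₀ < κ)
    (hP : ∀ o < lam.ord, ∃ μ : Cardinal.{0}, o < μ.ord ∧ μ.ord < lam.ord ∧ κ < μ ∧ μ.IsRegular ∧
      P μ) :
    ∃ δ μ, IsLadder κ δ μ ∧ (∀ i < κ.ord, (μ i).ord < lam.ord ∧ P (μ i)) ∧
      ∀ o < lam.ord, ∃ i < κ.ord, ∀ j, i ≤ j → j < κ.ord → o < (μ j).ord := by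
  have hG (o : Ordinal.{0}) : ∃ μ : Cardinal.{0}, o < lam.ord → μ.ord < lam.ord ∧ κ < μ ∧
      μ.IsRegular ∧ P μ ∧ ∃ ν, ℵ₀ ≤ ν ∧ o.card ≤ ν ∧ Order.succ ν < μ := by
    by_cases ho : o < lam.ord
    · obtain ⟨μ₁, h₁, h₁', hκ₁, -⟩ := hP o ho
      obtain ⟨μ₂, h₂, h₂', -⟩ := hP _ h₁'
      obtain ⟨μ₃, h₃, h₃', hκ₃, hreg, hPμ⟩ := hP _ h₂'
      refine ⟨μ₃, fun _ => ⟨h₃', hκ₃, hreg, hPμ, μ₁, (hκ.trans hκ₁).le, ?_, ?_⟩⟩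
      · exact (Cardinal.lt_ord.1 h₁).le
      · exact (Order.succ_le_of_lt (Cardinal.ord_lt_ord.1 h₂)).trans_lt
          (Cardinal.ord_lt_ord.1 h₃)
    · exact ⟨0, fun h => absurd h ho⟩
  choose G hGlam hGκ hGreg hGP hGν using hG
  have hlt_G {o} (ho : o < lam.ord) : o < (G o).ord := by
    obtain ⟨ν, -, h₁, h₂⟩ := hGν o ho
    exact Cardinal.lt_ord.2 (h₁.trans_lt ((Order.lt_succ ν).trans h₂))
  obtain ⟨e, he, hecof⟩ : ∃ e : Ordinal.{0} → Ordinal.{0}, (∀ i < κ.ord, e i < lam.ord) ∧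
      ∀ o < lam.ord, ∃ i < κ.ord, o ≤ e i := by
    classical
    obtain ⟨f, hf⟩ := Ordinal.exists_isFundamentalSeq (congrArg Cardinal.ord hcof)
    refine ⟨fun i => if h : i < κ.ord then (f ⟨i, h⟩).1 else 0, fun i hi => ?_, fun o ho => ?_⟩
    · simp only [hi, dif_pos]
      exact (f ⟨i, hi⟩).2
    · obtain ⟨_, ⟨⟨i, hi⟩, rfl⟩, h⟩ := hf.isCofinal_range ⟨o, ho⟩
      refine ⟨i, hi, ?_⟩
      simp only [dif_pos (mem_Iio.1 hi)]
      exact h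
  obtain ⟨δ, hδ⟩ : ∃ δ : Ordinal.{0} → Ordinal.{0}, ∀ i, δ i =
      max (e i) (⨆ k : Iio i, (G (δ k)).ord) :=
    ⟨(wellFounded_lt (α := Ordinal.{0})).fix fun i rec =>
      max (e i) (⨆ k : Iio i, (G (rec k.1 k.2)).ord), fun i => WellFounded.fix_eq _ _ i⟩
  have hδlt (i) (hi : i < κ.ord) : δ i < lam.ord := by
    induction i using WellFoundedLT.induction with
    | ind i ih =>
      rw [hδ]
      refine max_lt (he i hi) (Ordinal.lift_iSup_lt_of_lt_cof ?_ fun k =>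
        hGlam _ (ih k.1 k.2 (lt_trans k.2 hi)))
      rw [← Ordinal.lift_cof, hcof, Cardinal.lift_id'.{0, 1}, Cardinal.mk_Iio_ordinal,
        Cardinal.lift_lt]
      exact Cardinal.lt_ord.1 hi
  have hstep {i j} (hij : i < j) : (G (δ i)).ord ≤ δ j := by
    rw [hδ j]
    exact (Ordinal.le_iSup (fun k : Iio j => (G (δ k)).ord) ⟨i, hij⟩).trans (le_max_right _ _)
  refine ⟨δ, fun i => G (δ i), ⟨fun hi => hGreg _ (hδlt _ hi),
    fun hi => hκ.trans (hGκ _ (hδlt _ hi)), fun hi => hGν _ (hδlt _ hi), fun h _ => hstep h⟩,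
    fun i hi => ⟨hGlam _ (hδlt i hi), hGP _ (hδlt i hi)⟩, fun o ho => ?_⟩
  obtain ⟨i, hi, hoi⟩ := hecof o ho
  refine ⟨i, hi, fun j hij hj => ?_⟩
  have hoδ : o ≤ δ i := by
    rw [hδ]
    exact hoi.trans (le_max_left _ _)
  refine hoδ.trans_lt ?_
  rcases hij.eq_or_lt with rfl | hij
  · exact hlt_G (hδlt i hi)
  · exact (hlt_G (hδlt i hi)).trans_le ((hstep hij).trans (hlt_G (hδlt j hj)).le)

section Systems

variable {κ : Cardinal.{0}} {U : Set (Set Ordinal.{0})} {δ : Ordinal.{0} → Ordinal.{0}}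
  {μ : Ordinal.{0} → Cardinal.{0}} {c : Ordinal.{0} → Ordinal.{0} → Fin 2}

/-- `X` is a large subset of the `i`-th block `[δ i, μ i)`. -/
def IsLargeBlock (δ : Ordinal.{0} → Ordinal.{0}) (μ : Ordinal.{0} → Cardinal.{0})
    (i : Ordinal.{0}) (X : Set Ordinal.{0}) : Prop :=
  X ⊆ Ico (δ i) (μ i).ord ∧ Cardinal.lift.{1, 0} (μ i) ≤ #X

theorem IsLadder.mk_Iio_lt (hL : IsLadder κ δ μ) {i : Ordinal.{0}} (hi : i < κ.ord) :
    #(Iio (δ i)) < Cardinal.lift.{1, 0} (μ i) := by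
  obtain ⟨ν, -, h₁, h₂⟩ := hL.exists_succ_lt hi
  rw [Cardinal.mk_Iio_ordinal, Cardinal.lift_lt]
  exact h₁.trans_lt ((Order.lt_succ ν).trans h₂)

/-- If large blocks `B i` are such that each of their points is joined in colour `1` to only few
points of almost all `B j`, there are large `H i ⊆ B i` on a large set of indices between
which only colour `0` occurs. -/
theorem exists_thin_blocks (hU : IsFilterOn κ U) (hnorm : IsNormalOn κ U)
    (hL : IsLadder κ δ μ) (hgal : ∀ i < κ.ord, GalvinProp U (μ i) (μ i))
    {B : Ordinal.{0} → Set Ordinal.{0}} (hB : ∀ᶠ i in hU.toFilter, IsLargeBlock δ μ i (B i))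
    (hfew : ∀ᶠ i in hU.toFilter, ∀ α ∈ B i,
      ∀ᶠ j in hU.toFilter, ¬ IsLargeBlock δ μ j (B j ∩ oneAbove c α)) :
    ∃ (D : Set Ordinal.{0}) (H : Ordinal.{0} → Set Ordinal.{0}), D ∈ hU.toFilter ∧
      (∀ i ∈ D, i < κ.ord ∧ IsLargeBlock δ μ i (H i)) ∧
      ∀ i ∈ D, ∀ j ∈ D, i < j → ∀ α ∈ H i, ∀ β ∈ H j, β ∉ oneAbove c α := by
  let good : Ordinal.{0} → Prop := fun i => i < κ.ord ∧ IsLargeBlock δ μ i (B i) ∧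
    ∀ α ∈ B i, ∀ᶠ j in hU.toFilter, ¬ IsLargeBlock δ μ j (B j ∩ oneAbove c α)
  have hgood : ∀ᶠ i in hU.toFilter, good i := hU.eventually_lt.and (hB.and hfew)
  have hsub (i) : ∃ B' ⊆ B i, good i → Cardinal.lift.{1, 0} (μ i) ≤ #B' ∧
      ∀ᶠ j in hU.toFilter, ∀ α ∈ B', ¬ IsLargeBlock δ μ j (B j ∩ oneAbove c α) := by
    by_cases hi : good i
    · obtain ⟨B', h₁, h₂⟩ := (hgal i hi.1).exists_large hU hi.2.1.2 hi.2.2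
      exact ⟨B', h₁, fun _ => h₂⟩
    · exact ⟨∅, empty_subset _, fun h => absurd h hi⟩
  choose B' hB'B hB' using hsub
  have hdiag : ∀ᶠ j in hU.toFilter, ∀ i < j, good i →
      ∀ α ∈ B' i, ¬ IsLargeBlock δ μ j (B j ∩ oneAbove c α) := by
    refine hU.eventually_diag hnorm fun i _ => ?_
    by_cases hi : good i
    · filter_upwards [(hB' i hi).2] with j hj _ using hj
    · exact Filter.Eventually.of_forall fun j h => absurd h hi
  let bad : Ordinal.{0} → Set Ordinal.{0} := fun j => ⋃ i ∈ {i | i < j ∧ good i}, B' i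
  refine ⟨_, fun j => B' j \ ⋃ α ∈ bad j, oneAbove c α, hgood.and hdiag, ?_, ?_⟩
  · rintro j ⟨hj, hdj⟩
    have hsubset : B' j \ ⋃ α ∈ bad j, oneAbove c α ⊆ B j := sdiff_subset.trans (hB'B j)
    refine ⟨hj.1, hsubset.trans hj.2.1.1, ?_⟩
    by_contra! hsmall
    have hreg : (Cardinal.lift.{1, 0} (μ j)).IsRegular := (hL.isRegular hj.1).lift
    have hbad : bad j ⊆ Iio (δ j) := by
      refine iUnion₂_subset fun i hi α hα => ?_
      exact (hi.2.2.1.1 (hB'B i hα)).2.trans_le (hL.le_of_lt hi.1 hj.1)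
    have hunion : #(⋃ α ∈ bad j, B j ∩ oneAbove c α : Set Ordinal.{0}) <
        Cardinal.lift.{1, 0} (μ j) := by
      refine (card_biUnion_lt_iff_forall_of_isRegular hreg
        ((mk_le_mk_of_subset hbad).trans_lt (hL.mk_Iio_lt hj.1))).2 fun α hα => ?_
      simp only [bad, mem_iUnion] at hα
      obtain ⟨i, hi, hα⟩ := hα
      by_contra! h
      exact hdj i hi.1 hi.2 α hα ⟨inter_subset_left.trans hj.2.1.1, h⟩
    refine ((hB' j hj).1.trans (mk_le_mk_of_subset (t := (B' j \ ⋃ α ∈ bad j, oneAbove c α) ∪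
      ⋃ α ∈ bad j, B j ∩ oneAbove c α) fun β hβ => ?_)).not_gt
      ((mk_union_le _ _).trans_lt (Cardinal.add_lt_of_lt hreg.aleph0_le hsmall hunion))
    by_cases h : β ∈ ⋃ α ∈ bad j, oneAbove c α
    · refine Or.inr ?_
      simp only [mem_iUnion] at h ⊢
      obtain ⟨α, hα, h⟩ := h
      exact ⟨α, hα, hB'B j hβ, h⟩
    · exact Or.inl ⟨hβ, h⟩
  · rintro i ⟨hi, -⟩ j - hij α hα β hβ h
    exact hβ.2 (mem_biUnion (mem_biUnion ⟨hij, hi⟩ hα.1) h)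

/-- If every sequence of large blocks has frequently a point joined in colour `1` to many points
of almost all blocks, there is a colour-`1` set of type `ω + 1`. -/
theorem exists_omegaSucc_of_forall_blocks (hU : IsUltraOn κ U) (hcomp : IsKappaComplete κ U)
    (hcb : ContainsCobounded κ U) (hκ : ℵ₀ < κ) (hL : IsLadder κ δ μ)
    (hmany : ∀ B : Ordinal.{0} → Set Ordinal.{0},
      (∀ᶠ i in hU.1.toFilter, IsLargeBlock δ μ i (B i)) →
      ∃ᶠ i in hU.1.toFilter, ∃ α ∈ B i,
        ∀ᶠ j in hU.1.toFilter, IsLargeBlock δ μ j (B j ∩ oneAbove c α)) :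
    ∃ i < κ.ord, ∃ B ⊆ Iio (μ i).ord, OtpOmegaSucc B ∧ Mono c B 1 := by
  classical
  by_contra! hno
  have hν (i : Ordinal.{0}) : ∃ ν, i < κ.ord → ℵ₀ ≤ ν ∧ (δ i).card ≤ ν ∧ Order.succ ν < μ i := by
    by_cases hi : i < κ.ord
    · obtain ⟨ν, h⟩ := hL.exists_succ_lt hi
      exact ⟨ν, fun _ => h⟩
    · exact ⟨0, fun h => absurd h hi⟩
  choose ν hν using hν
  have hrank (i t : Ordinal.{0}) : ∃ R : Finset Ordinal.{0} → Ordinal.{0}, i < κ.ord →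
      t ∈ Ico (δ i) (μ i).ord → (∀ s, R s < (Order.succ (ν i)).ord) ∧
      ∀ s : Finset Ordinal.{0}, ∀ α < δ i, (∀ a ∈ s, α ∈ oneAbove c a) → t ∈ oneAbove c α →
        R (insert α s) < R s := by
    by_cases h : i < κ.ord ∧ t ∈ Ico (δ i) (μ i).ord
    · obtain ⟨hi, ht⟩ := h
      obtain ⟨R, hR⟩ := exists_rank (c := c) (t := t) (hν i hi).1 (hν i hi).2.1
        fun g hgδ hg hgt => by
          obtain ⟨h₁, h₂⟩ := otpOmegaSucc_and_mono_of_seq hg hgt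
          refine hno i hi _ ?_ h₁ h₂
          rintro _ (⟨n, rfl⟩ | rfl)
          · exact (hgδ n).trans (ht.1.trans_lt ht.2)
          · exact ht.2
      exact ⟨R, fun _ _ => hR⟩
    · exact ⟨fun _ => 0, fun hi ht => absurd ⟨hi, ht⟩ h⟩
  choose R hR using hrank
  have hconst (s) (X : Ordinal.{0} → Set Ordinal.{0}) (i) : ∃ ρ, i < κ.ord →
      IsLargeBlock δ μ i (X i) → IsLargeBlock δ μ i {β ∈ X i | R i β s = ρ} := by
    by_cases h : i < κ.ord ∧ IsLargeBlock δ μ i (X i)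
    · obtain ⟨hi, hX⟩ := h
      obtain ⟨ρ, hρ⟩ := exists_large_fiber (hL.isRegular hi) hX.2 (fun β => R i β s)
        (by rw [Cardinal.card_ord]; exact (hν i hi).2.2) fun β hβ => (hR i β hi (hX.1 hβ)).1 s
      exact ⟨ρ, fun _ _ => ⟨(sep_subset _ _).trans hX.1, hρ⟩⟩
    · exact ⟨0, fun hi hX => absurd ⟨hi, hX⟩ h⟩
  choose ρ hρ using hconst
  let Inv : Finset Ordinal.{0} × (Ordinal.{0} → Set Ordinal.{0}) × (Ordinal.{0} → Ordinal.{0}) →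
      Prop := fun p => ∀ᶠ j in hU.1.toFilter, IsLargeBlock δ μ j (p.2.1 j) ∧
        ∀ β ∈ p.2.1 j, R j β p.1 = p.2.2 j ∧ ∀ a ∈ p.1, β ∈ oneAbove c a
  have hinit : ∃ p, Inv p := by
    let X : Ordinal.{0} → Set Ordinal.{0} := fun i => Ico (δ i) (μ i).ord
    refine ⟨⟨∅, fun i => {β ∈ X i | R i β ∅ = ρ ∅ X i}, ρ ∅ X⟩, ?_⟩
    filter_upwards [hU.1.eventually_lt] with i hi
    refine ⟨hρ ∅ X i hi ⟨Subset.rfl, ?_⟩, fun β hβ => ⟨hβ.2, by simp⟩⟩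
    by_contra! hsmall
    have hcov : Iio (μ i).ord ⊆ Iio (δ i) ∪ X i := fun β hβ =>
      (lt_or_ge β (δ i)).imp id fun h => ⟨h, hβ⟩
    have hlt := (mk_le_mk_of_subset hcov).trans_lt ((mk_union_le _ _).trans_lt
      (Cardinal.add_lt_of_lt (hL.isRegular hi).lift.aleph0_le (hL.mk_Iio_lt hi) hsmall))
    rw [Cardinal.mk_Iio_ordinal, Cardinal.card_ord] at hlt
    exact lt_irrefl _ hlt
  have hstep (p : Subtype Inv) : ∃ q : Subtype Inv,
      ∀ᶠ j in hU.1.toFilter, q.1.2.2 j < p.1.2.2 j := by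
    obtain ⟨⟨s, B, r⟩, hp⟩ := p
    obtain ⟨i, ⟨⟨α, hα, hαj⟩, hi⟩, hiB⟩ := (((hmany B (hp.mono fun j h => h.1)).and_eventually
      hU.1.eventually_lt).and_eventually hp).exists
    let X : Ordinal.{0} → Set Ordinal.{0} := fun j => B j ∩ oneAbove c α
    have hlarge : ∀ᶠ j in hU.1.toFilter,
        IsLargeBlock δ μ j {β ∈ X j | R j β (insert α s) = ρ (insert α s) X j} := by
      filter_upwards [hαj, hU.1.eventually_lt] with j hj hjκ using hρ _ X j hjκ hj
    refine ⟨⟨⟨insert α s, fun j => {β ∈ X j | R j β (insert α s) = ρ (insert α s) X j},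
      ρ (insert α s) X⟩, ?_⟩, ?_⟩
    · filter_upwards [hp, hlarge] with j hpj hj
      refine ⟨hj, fun β hβ => ⟨hβ.2, fun a ha => ?_⟩⟩
      rcases Finset.mem_insert.1 ha with rfl | ha
      · exact hβ.1.2
      · exact (hpj.2 β hβ.1.1).2 a ha
    · filter_upwards [hp, hlarge, hU.1.eventually_lt, hU.1.eventually_gt hcb hκ.le hi]
        with j hpj hj hjκ hij
      have hne : {β ∈ X j | R j β (insert α s) = ρ (insert α s) X j}.Nonempty := by
        rw [← nonempty_coe_sort, ← Cardinal.mk_ne_zero_iff]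
        exact ((hL.isRegular hjκ).lift.pos.trans_le hj.2).ne'
      obtain ⟨β, hβ, hβρ⟩ := hne
      rw [← hβρ, ← (hpj.2 β hβ.1).1]
      exact (hR j β hjκ (hpj.1.1 hβ.1)).2 s α ((hiB.1.1 hα).2.trans_le (hL.le_of_lt hij hjκ))
        (hiB.2 α hα).2 hβ.2
  obtain ⟨p₀, hp₀⟩ := hinit
  choose next hnext using hstep
  have hall := hU.1.eventually_forall_nat hcomp hκ fun n => hnext (next^[n] ⟨p₀, hp₀⟩)
  have := hU.1.toFilter_neBot
  obtain ⟨j, hj⟩ := hall.exists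
  refine (wellFounded_iff_isEmpty_descending_chain.1 (wellFounded_lt (α := Ordinal.{0}))).false
    ⟨fun n => (next^[n] ⟨p₀, hp₀⟩).1.2.2 j, fun n => ?_⟩
  simpa only [Nat.succ_eq_add_one, Function.iterate_succ_apply'] using hj n

end Systems

/-- if `U` is a normal `κ`-complete ultrafilter on the measurable
cardinal `κ`, `λ` is singular with `cf(λ) = κ > ℵ₀`, and `Gal(U, μ, μ)` holds
for cofinally many regular `μ < λ` with `μ > κ`, then `λ → (λ, ω+1)²`. -/
theorem partition_from_cofinal_Galvin (κ lam : Cardinal.{0}) (hunc : ℵ₀ < κ)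
    (U : Set (Set Ordinal.{0})) (hU : IsUltraOn κ U) (hUcomp : IsKappaComplete κ U)
    (hUcb : ContainsCobounded κ U) (hUnorm : IsNormalOn κ U)
    (hcof : lam.ord.cof = κ) (hlt : κ < lam)
    (hgal : ∀ o < lam.ord, ∃ μ : Cardinal.{0}, o < μ.ord ∧ μ.ord < lam.ord ∧
      κ < μ ∧ μ.IsRegular ∧ GalvinProp U μ μ) :
    PartitionOmegaSuccRel lam := by
  intro c
  refine or_iff_not_imp_right.2 fun hno => ?_
  push Not at hno
  obtain ⟨δ, μ, hL, hμ, hμcof⟩ := exists_isLadder hcof hunc hgal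
  have hno' {i} (hi : i < κ.ord) (B : Set Ordinal.{0}) (hB : B ⊆ Iio (μ i).ord)
      (h₁ : OtpOmegaSucc B) : ¬ Mono c B 1 :=
    hno B (hB.trans (Iio_subset_Iio (hμ i hi).1.le)) h₁
  have := hU.1.toFilter_neBot
  obtain ⟨B, hB, hfew⟩ : ∃ B : Ordinal.{0} → Set Ordinal.{0},
      (∀ᶠ i in hU.1.toFilter, IsLargeBlock δ μ i (B i)) ∧ ∀ᶠ i in hU.1.toFilter, ∀ α ∈ B i,
        ∀ᶠ j in hU.1.toFilter, ¬ IsLargeBlock δ μ j (B j ∩ oneAbove c α) := by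
    by_contra! hmany
    obtain ⟨i, hi, B, hB, h₁, h₂⟩ := exists_omegaSucc_of_forall_blocks (c := c) hU hUcomp hUcb
      hunc hL fun B hB => (hmany B hB).mono fun i ⟨α, hα, h⟩ => by
        refine ⟨α, hα, ?_⟩
        by_contra hn
        exact h (hU.eventually_not hn)
    exact hno' hi B hB h₁ h₂
  obtain ⟨D, H, hD, hHlarge, hH⟩ := exists_thin_blocks hU.1 hUnorm hL (fun i hi => (hμ i hi).2)
    hB hfew
  have hK (i) : ∃ K ⊆ H i, i ∈ D → Cardinal.lift.{1, 0} (μ i) ≤ #K ∧ Mono c K 0 := by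
    by_cases hi : i ∈ D
    · obtain ⟨hiκ, hsub, hcard⟩ := hHlarge i hi
      have hsub' : H i ⊆ Iio (μ i).ord := fun β hβ => (hsub hβ).2
      obtain ⟨K, hKH, hK⟩ | ⟨B, hBH, h₁, h₂⟩ := exists_mono_or_omegaSucc_of_isRegular
        (hL.isRegular hiκ) (hL.aleph0_lt hiκ) c hsub' hcard
      · exact ⟨K, hKH, fun _ => hK⟩
      · exact absurd h₂ (hno' hiκ B (hBH.trans hsub') h₁)
    · exact ⟨∅, empty_subset _, fun h => absurd h hi⟩
  choose K hKH hK using hK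
  have hsub : (⋃ i ∈ D, K i) ⊆ Iio lam.ord := iUnion₂_subset fun i hi β hβ =>
    ((hHlarge i hi).2.1 (hKH i hβ)).2.trans (hμ i (hHlarge i hi).1).1
  refine ⟨⋃ i ∈ D, K i, hsub, le_antisymm ?_ ?_, ?_⟩
  · simpa [Cardinal.mk_Iio_ordinal] using mk_le_mk_of_subset hsub
  · by_contra! hlt'
    obtain ⟨ν, hν⟩ := Cardinal.mem_range_lift_of_le hlt'.le
    rw [← hν, Cardinal.lift_lt] at hlt'
    obtain ⟨i, hi, hio⟩ := hμcof ν.ord (Cardinal.ord_lt_ord.2 hlt')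
    obtain ⟨j, hjD, hij⟩ :=
      (Filter.Eventually.and hD (hU.1.eventually_gt hUcb hunc.le hi)).exists
    have hle : #(K j) ≤ #(⋃ i ∈ D, K i : Set Ordinal.{0}) :=
      mk_le_mk_of_subset (subset_biUnion_of_mem (u := K) hjD)
    have hge := (hK j hjD).1.trans hle
    rw [← hν, Cardinal.lift_le] at hge
    exact hge.not_gt (Cardinal.ord_lt_ord.1 (hio j hij.le (hHlarge j hjD).1))
  · intro α hα β hβ hαβ
    simp only [mem_iUnion] at hα hβ
    obtain ⟨i, hi, hα⟩ := hα
    obtain ⟨j, hj, hβ⟩ := hβ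
    rcases lt_trichotomy i j with hij | rfl | hji
    · have h1 : c α β ≠ 1 := fun h => hH i hi j hj hij α (hKH i hα) β (hKH j hβ) ⟨hαβ, h⟩
      omega
    · exact (hK i hi).2 α hα β hβ hαβ
    · refine absurd hαβ (lt_asymm (((hHlarge j hj).2.1 (hKH j hβ)).2.trans_le ?_))
      exact (hL.le_of_lt hji (hHlarge i hi).1).trans ((hHlarge i hi).2.1 (hKH i hα)).1
end
end
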